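/- The fifth moment of the self-similar profile satisfies ∫₀^∞ z⁵ g(z) dz = 16·4!· g''(0) = −96 Γ(3/4)/π. -/

import Mathlib

open MeasureTheory Real Filter Set

/-- Fourth-order heat kernel `G_t(x) = (1/π)∫₀^∞ e^{−t k⁴} cos(kx) dk`. -/
noncomputable def G (t x : ℝ) : ℝ :=
  (1 / Real.pi) * ∫ k in Set.Ioi (0:ℝ), Real.exp (-t * k ^ 4) * Real.cos (k * x)

/-- First spatial derivative `G_t'(x) = −(1/π)∫₀^∞ k e^{−t k⁴} sin(kx) dk`. -/
noncomputable def G₁ (t x : ℝ) : ℝ :=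
  -(1 / Real.pi) * ∫ k in Set.Ioi (0:ℝ), k * Real.exp (-t * k ^ 4) * Real.sin (k * x)

/-- Second spatial derivative `G_t''(x) = −(1/π)∫₀^∞ k² e^{−t k⁴} cos(kx) dk`. -/
noncomputable def G₂ (t x : ℝ) : ℝ :=
  -(1 / Real.pi) * ∫ k in Set.Ioi (0:ℝ), k ^ 2 * Real.exp (-t * k ^ 4) * Real.cos (k * x)

/-- Self-similar profile `g(z) = (1/π)∫₀^∞ e^{−k⁴} cos(kz) dk`. -/
noncomputable def gprof (z : ℝ) : ℝ :=
  (1 / Real.pi) * ∫ k in Set.Ioi (0:ℝ), Real.exp (-k ^ 4) * Real.cos (k * z)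

lemma integrable_pow_mul_exp_neg_pow_four (n : ℕ) :
    Integrable (fun k : ℝ => k ^ n * Real.exp (-k ^ 4)) := by
  have h := (integrable_rpow_mul_exp_neg_mul_sq (b := 1) one_pos (s := (n : ℝ))
    (by linarith [n.cast_nonneg (α := ℝ)])).const_mul (Real.exp 1)
  refine h.mono (by fun_prop) (Eventually.of_forall fun k => ?_)
  have hexp : Real.exp (-k ^ 4) ≤ Real.exp 1 * Real.exp (-1 * k ^ 2) := by
    rw [← Real.exp_add]
    exact Real.exp_le_exp.2 (by nlinarith [sq_nonneg (k ^ 2 - 1), sq_nonneg k])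
  simp only [Real.rpow_natCast, norm_mul, Real.norm_eq_abs, Real.abs_exp]
  calc |k ^ n| * Real.exp (-k ^ 4) ≤ |k ^ n| * (Real.exp 1 * Real.exp (-1 * k ^ 2)) := by gcongr
    _ = _ := by ring

/-- The integrand `kⁿ e^{−k⁴} e^{ikz}`. -/
noncomputable def quarticIntegrand (n : ℕ) (z k : ℝ) : ℂ :=
  ((k ^ n * Real.exp (-k ^ 4) : ℝ) : ℂ) * Complex.exp (((k * z : ℝ) : ℂ) * Complex.I)

/-- The Fourier integral `∫ kⁿ e^{−k⁴} e^{ikz} dk` over the real line. -/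
noncomputable def quarticFourier (n : ℕ) (z : ℝ) : ℂ :=
  ∫ k : ℝ, quarticIntegrand n z k

lemma norm_quarticIntegrand (n : ℕ) (z k : ℝ) :
    ‖quarticIntegrand n z k‖ = ‖k ^ n * Real.exp (-k ^ 4)‖ := by
  rw [quarticIntegrand, norm_mul, Complex.norm_exp_ofReal_mul_I, mul_one, Complex.norm_real]

lemma continuous_quarticIntegrand (n : ℕ) (z : ℝ) : Continuous (quarticIntegrand n z) := by
  unfold quarticIntegrand
  fun_prop

lemma integrable_quarticIntegrand (n : ℕ) (z : ℝ) : Integrable (quarticIntegrand n z) :=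
  (integrable_pow_mul_exp_neg_pow_four n).mono
    (continuous_quarticIntegrand n z).aestronglyMeasurable
    (Eventually.of_forall fun k => (norm_quarticIntegrand n z k).le)

lemma hasDerivAt_quarticFourier (n : ℕ) (z : ℝ) :
    HasDerivAt (quarticFourier n) (Complex.I * quarticFourier (n + 1) z) z := by
  have h := (hasDerivAt_integral_of_dominated_loc_of_deriv_le (μ := volume) (x₀ := z)
    (F := quarticIntegrand n) (F' := fun z k => Complex.I * quarticIntegrand (n + 1) z k)
    (bound := fun k => ‖k ^ (n + 1) * Real.exp (-k ^ 4)‖) univ_mem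
    (Eventually.of_forall fun z => (continuous_quarticIntegrand n z).aestronglyMeasurable)
    (integrable_quarticIntegrand n z)
    ((continuous_quarticIntegrand (n + 1) z).const_smul Complex.I).aestronglyMeasurable
    (Eventually.of_forall fun k z _ => by
      rw [norm_mul, Complex.norm_I, one_mul, norm_quarticIntegrand])
    (integrable_pow_mul_exp_neg_pow_four (n + 1)).norm
    (Eventually.of_forall fun k z _ => by
      have h := (((((hasDerivAt_id z).const_mul k).ofReal_comp).mul_const Complex.I).cexp).const_mul
        ((k ^ n * Real.exp (-k ^ 4) : ℝ) : ℂ)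
      refine h.congr_deriv ?_
      simp only [quarticIntegrand, id]
      push_cast
      ring)).2
  rwa [integral_const_mul] at h

/-- Integration by parts for `∫ kⁿ e^{−k⁴} e^{ikz} dk`. -/
lemma mul_quarticFourier (n : ℕ) (z : ℝ) :
    (z : ℂ) * quarticFourier n z =
      Complex.I * (n * quarticFourier (n - 1) z - 4 * quarticFourier (n + 3) z) := by
  have h := integral_eq_zero_of_hasDerivAt_of_integrable (f := quarticIntegrand n z)
    (f' := fun k => (n * quarticIntegrand (n - 1) z k - 4 * quarticIntegrand (n + 3) z k)
      + z * Complex.I * quarticIntegrand n z k) (fun k => by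
      have h₁ := ((((hasDerivAt_id k).mul_const z).ofReal_comp).mul_const Complex.I).cexp
      have h₂ := ((hasDerivAt_pow n k).mul ((hasDerivAt_pow 4 k).neg.exp)).ofReal_comp
      refine (h₂.mul h₁).congr_deriv ?_
      simp only [quarticIntegrand, id, Pi.neg_apply, Pi.mul_apply]
      push_cast
      ring)
    ((((integrable_quarticIntegrand _ z).const_mul _).sub
      ((integrable_quarticIntegrand _ z).const_mul _)).add
      ((integrable_quarticIntegrand _ z).const_mul _))
    (integrable_quarticIntegrand n z)
  rw [integral_add
      (f := fun k => n * quarticIntegrand (n - 1) z k - 4 * quarticIntegrand (n + 3) z k)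
      (((integrable_quarticIntegrand _ z).const_mul _).sub
        ((integrable_quarticIntegrand _ z).const_mul _))
      ((integrable_quarticIntegrand _ z).const_mul _),
    integral_sub ((integrable_quarticIntegrand _ z).const_mul _)
      ((integrable_quarticIntegrand _ z).const_mul _)] at h
  simp only [integral_const_mul] at h
  change (n * quarticFourier (n - 1) z - 4 * quarticFourier (n + 3) z)
      + z * Complex.I * quarticFourier n z = 0 at h
  linear_combination (-Complex.I) * h + (z * quarticFourier n z) * Complex.I_mul_I

lemma exists_norm_pow_mul_quarticFourier_le (m n : ℕ) :
    ∃ C : ℝ, ∀ z : ℝ, ‖(z : ℂ) ^ m * quarticFourier n z‖ ≤ C := by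
  induction m generalizing n with
  | zero =>
    refine ⟨∫ k : ℝ, ‖k ^ n * Real.exp (-k ^ 4)‖, fun z => ?_⟩
    rw [pow_zero, one_mul]
    refine (norm_integral_le_integral_norm _).trans_eq ?_
    simp only [norm_quarticIntegrand]
  | succ m ih =>
    obtain ⟨A, hA⟩ := ih (n - 1)
    obtain ⟨B, hB⟩ := ih (n + 3)
    refine ⟨n * A + 4 * B, fun z => ?_⟩
    have h : (z : ℂ) ^ (m + 1) * quarticFourier n z = Complex.I *
        (n * (z ^ m * quarticFourier (n - 1) z) - 4 * (z ^ m * quarticFourier (n + 3) z)) := by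
      rw [pow_succ, mul_assoc, mul_quarticFourier]
      ring
    rw [h, norm_mul, Complex.norm_I, one_mul]
    refine (norm_sub_le _ _).trans ?_
    rw [norm_mul (n : ℂ), norm_mul (4 : ℂ), Complex.norm_natCast, Complex.norm_ofNat]
    gcongr
    · exact hA z
    · exact hB z

lemma tendsto_pow_mul_quarticFourier (m n : ℕ) :
    Tendsto (fun z : ℝ => (z : ℂ) ^ m * quarticFourier n z) atTop (nhds 0) := by
  obtain ⟨C, hC⟩ := exists_norm_pow_mul_quarticFourier_le (m + 1) n
  refine squeeze_zero_norm' (a := fun z : ℝ => C / z) ?_ (tendsto_id.const_div_atTop C)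
  filter_upwards [eventually_gt_atTop 0] with z hz
  rw [le_div_iff₀ hz]
  refine le_trans (le_of_eq ?_) (hC z)
  rw [pow_succ, norm_mul, norm_mul, norm_mul, Complex.norm_real z, Real.norm_of_nonneg hz.le]
  ring

lemma continuous_quarticFourier (n : ℕ) : Continuous (quarticFourier n) :=
  continuous_iff_continuousAt.2 fun z => (hasDerivAt_quarticFourier n z).continuousAt

lemma integrable_pow_mul_quarticFourier (m n : ℕ) :
    Integrable (fun z : ℝ => (z : ℂ) ^ m * quarticFourier n z) := by
  obtain ⟨A, hA⟩ := exists_norm_pow_mul_quarticFourier_le m n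
  obtain ⟨B, hB⟩ := exists_norm_pow_mul_quarticFourier_le (m + 2) n
  refine (integrable_inv_one_add_sq.const_mul (A + B)).mono'
    ((Complex.continuous_ofReal.pow m).mul (continuous_quarticFourier n)).aestronglyMeasurable
    (Eventually.of_forall fun z => ?_)
  rw [← div_eq_mul_inv, le_div_iff₀ (by positivity)]
  have h : ‖(z : ℂ) ^ (m + 2) * quarticFourier n z‖
      = ‖(z : ℂ) ^ m * quarticFourier n z‖ * z ^ 2 := by
    rw [pow_add, norm_mul, norm_mul, norm_mul, norm_pow (z : ℂ) 2, Complex.norm_real,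
      Real.norm_eq_abs, sq_abs]
    ring
  linarith [hA z, hB z]

lemma integral_pow_five_mul_quarticFourier_zero :
    ∫ z in Ioi (0 : ℝ), (z : ℂ) ^ 5 * quarticFourier 0 z = -384 * quarticFourier 2 0 := by
  have hode (z : ℝ) : (z : ℂ) * quarticFourier 0 z = -4 * Complex.I * quarticFourier 3 z := by
    rw [mul_quarticFourier]
    push_cast
    ring
  have hderiv (z : ℝ) : HasDerivAt (fun z : ℝ => 4 * (-((z : ℂ) ^ 4 * quarticFourier 2 z)
      - 4 * Complex.I * ((z : ℂ) ^ 3 * quarticFourier 1 z)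
      + 12 * ((z : ℂ) ^ 2 * quarticFourier 0 z) + 96 * ((z : ℂ) ^ 0 * quarticFourier 2 z)))
      ((z : ℂ) ^ 5 * quarticFourier 0 z) z := by
    have hp (m n : ℕ) := ((hasDerivAt_id z).ofReal_comp.pow m).mul (hasDerivAt_quarticFourier n z)
    have h := (((((hp 4 2).neg.sub ((hp 3 1).const_mul (4 * Complex.I))).add
      ((hp 2 0).const_mul 12)).add ((hp 0 2).const_mul 96)).const_mul 4)
    refine h.congr_deriv ?_
    simp
    linear_combination (96 - z ^ 4) * hode z
      - (16 * z ^ 3 * quarticFourier 2 z) * Complex.I_mul_I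
  have hlim := ((((tendsto_pow_mul_quarticFourier 4 2).neg.sub
    ((tendsto_pow_mul_quarticFourier 3 1).const_mul (4 * Complex.I))).add
    ((tendsto_pow_mul_quarticFourier 2 0).const_mul 12)).add
    ((tendsto_pow_mul_quarticFourier 0 2).const_mul 96)).const_mul 4
  rw [integral_Ioi_of_hasDerivAt_of_tendsto (hderiv 0).continuousAt.continuousWithinAt
    (fun z _ => hderiv z) (integrable_pow_mul_quarticFourier 5 0).integrableOn hlim]
  simp
  ring

lemma re_quarticFourier (n : ℕ) (z : ℝ) :
    (quarticFourier n z).re = ∫ k : ℝ, k ^ n * Real.exp (-k ^ 4) * Real.cos (k * z) := by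
  rw [quarticFourier, ← RCLike.re_eq_complex_re, ← integral_re (integrable_quarticIntegrand n z)]
  refine integral_congr_ae (Eventually.of_forall fun k => ?_)
  simp only [quarticIntegrand, RCLike.re_eq_complex_re]
  rw [Complex.re_ofReal_mul, Complex.exp_ofReal_mul_I_re]

lemma re_quarticFourier_two_mul (n : ℕ) (z : ℝ) :
    (quarticFourier (2 * n) z).re =
      2 * ∫ k in Ioi (0 : ℝ), k ^ (2 * n) * Real.exp (-k ^ 4) * Real.cos (k * z) := by
  rw [re_quarticFourier, ← integral_comp_abs]
  refine integral_congr_ae (Eventually.of_forall fun k => ?_)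
  rcases abs_choice k with h | h <;> simp [h, pow_mul, Even.neg_pow (show Even 4 by decide)]

lemma gprof_eq (z : ℝ) : gprof z = (quarticFourier 0 z).re / (2 * Real.pi) := by
  have h := re_quarticFourier_two_mul 0 z
  simp only [mul_zero, pow_zero, one_mul] at h
  rw [h, gprof, mul_div_mul_left _ _ two_ne_zero, one_div_mul_eq_div]

lemma quarticFourier_two_zero_re : (quarticFourier 2 0).re = Real.Gamma (3 / 4) / 2 := by
  have h := re_quarticFourier_two_mul 1 0
  have hG := integral_rpow_mul_exp_neg_rpow (p := 4) (q := 2) (by norm_num) (by norm_num)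
  norm_cast at hG
  norm_num at h hG
  rw [h, hG]
  ring

lemma iteratedDeriv_two_gprof_zero :
    iteratedDeriv 2 gprof 0 = -(Real.Gamma (3 / 4) / (4 * Real.pi)) := by
  have h₁ (z : ℝ) : HasDerivAt gprof
      ((Complex.I * quarticFourier 1 z).re / (2 * Real.pi)) z := by
    rw [funext gprof_eq]
    exact (Complex.reCLM.hasFDerivAt.comp_hasDerivAt z
      (hasDerivAt_quarticFourier 0 z)).div_const _
  have h₂ : HasDerivAt (fun z => (Complex.I * quarticFourier 1 z).re / (2 * Real.pi))
      ((Complex.I * (Complex.I * quarticFourier 2 0)).re / (2 * Real.pi)) 0 :=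
    (Complex.reCLM.hasFDerivAt.comp_hasDerivAt 0
      ((hasDerivAt_quarticFourier 1 0).const_mul Complex.I)).div_const _
  rw [iteratedDeriv_succ, iteratedDeriv_one, funext fun z => (h₁ z).deriv, h₂.deriv,
    ← mul_assoc, Complex.I_mul_I, neg_one_mul, Complex.neg_re, quarticFourier_two_zero_re]
  field_simp
  norm_num

lemma integral_pow_five_mul_gprof :
    ∫ z in Ioi (0 : ℝ), z ^ 5 * gprof z = -(96 * Real.Gamma (3 / 4) / Real.pi) := by
  have h : ∀ z : ℝ, z ^ 5 * gprof z =
      RCLike.re ((z : ℂ) ^ 5 * quarticFourier 0 z) / (2 * Real.pi) := fun z => by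
    rw [gprof_eq, RCLike.re_eq_complex_re, ← Complex.ofReal_pow, Complex.re_ofReal_mul]
    ring
  simp only [h]
  rw [integral_div, integral_re (integrable_pow_mul_quarticFourier 5 0).integrableOn,
    integral_pow_five_mul_quarticFourier_zero, RCLike.re_eq_complex_re]
  have h384 : (-384 : ℂ) = ((-384 : ℝ) : ℂ) := by norm_num
  rw [h384, Complex.re_ofReal_mul, quarticFourier_two_zero_re]
  field_simp
  norm_num

/-- `∫₀^∞ z⁵ g(z) dz = 16·4!·g''(0) = −96 Γ(3/4)/π`. -/
theorem stmt16 :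
    (∫ z in Set.Ioi (0:ℝ), z ^ 5 * gprof z) = 16 * (Nat.factorial 4 : ℝ) * iteratedDeriv 2 gprof 0 ∧
    (∫ z in Set.Ioi (0:ℝ), z ^ 5 * gprof z) = -(96 * Real.Gamma (3/4) / Real.pi) := by
  refine ⟨?_, integral_pow_five_mul_gprof⟩
  rw [integral_pow_five_mul_gprof, iteratedDeriv_two_gprof_zero]
  norm_num [Nat.factorial]
  field_simp
  norm_num
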